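/- Let β be odd and let C = ⟨(b | 0), (ℓ | fh + 2f)⟩ be a Z2Z4-additive cyclic code in standard form, where fhg = x^β − 1 in Z4[x] and b divides x^α − 1 in Z2[x]. Then there exist a divisor r of f in Z4[x], a divisor b_r of b in Z2[x], and a polynomial ℓ_r ∈ Z2[x] such that R(C) = ⟨(b_r | 0), (ℓ_r | fh + 2(f/r))⟩. -/

import Mathlib

open Polynomial

namespace Z2Z4

variable {α β : ℕ}

/-- The ambient space `ℤ₂^α × ℤ₄^β`. -/
abbrev V (α β : ℕ) := (Fin α → ZMod 2) × (Fin β → ZMod 4)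

/-- The binary ambient space `ℤ₂^(α+2β)`, written as a product. -/
abbrev B (α β : ℕ) := (Fin α → ZMod 2) × ((Fin β → ZMod 2) × (Fin β → ZMod 2))

/-- The double cyclic shift `π(u | u') = (u_{α-1},u_0,…,u_{α-2} | u'_{β-1},u'_0,…,u'_{β-2})`. -/
def shift (v : V α β) : V α β :=
  (fun i => v.1 ((finRotate α).symm i), fun i => v.2 ((finRotate β).symm i))

/-- For `z = t + 2h` with `t,h ∈ {0,1}`, this is `h`. -/
def grayHat (z : ZMod 4) : ZMod 2 := ((z.val / 2 : ℕ) : ZMod 2)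

/-- For `z = t + 2h` with `t,h ∈ {0,1}`, this is `t`. -/
def grayTilde (z : ZMod 4) : ZMod 2 := ((z.val % 2 : ℕ) : ZMod 2)

/-- The Gray map `φ(u') = (û', ũ' + û')`. -/
def phi (u : Fin β → ZMod 4) : (Fin β → ZMod 2) × (Fin β → ZMod 2) :=
  (fun i => grayHat (u i), fun i => grayTilde (u i) + grayHat (u i))

/-- The extended Gray map `Φ(u | u') = (u, φ(u'))`. -/
def Phi (v : V α β) : B α β := (v.1, phi v.2)

/-- `2v*w = (0 | 2(v' * w'))`, componentwise product on the quaternary part. -/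
def twoStar (v w : V α β) : V α β := (0, fun i => 2 * v.2 i * w.2 i)

/-- The kernel `K(C) = {v ∈ C : 2v*w ∈ C for all w ∈ C}`. -/
def K (C : Set (V α β)) : Set (V α β) :=
  {v ∈ C | ∀ w ∈ C, twoStar v w ∈ C}

/-- `R(C) = {v : Φ(v) ∈ ⟨Φ(C)⟩}`. -/
def R (C : Set (V α β)) : Set (V α β) :=
  {v | Phi v ∈ Submodule.span (ZMod 2) (Phi '' C)}

/-- The kernel of a quaternary code `D ⊆ ℤ₄^β`. -/
def KQ (D : Set (Fin β → ZMod 4)) : Set (Fin β → ZMod 4) :=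
  {v ∈ D | ∀ w ∈ D, (fun i => 2 * v i * w i) ∈ D}

/-- `R(D) = {v' : φ(v') ∈ ⟨φ(D)⟩}` for a quaternary code `D ⊆ ℤ₄^β`. -/
def RQ (D : Set (Fin β → ZMod 4)) : Set (Fin β → ZMod 4) :=
  {v | phi v ∈ Submodule.span (ZMod 2) (phi '' D)}

/-- The kernel of a binary code: `{x : x + D = D}`. -/
def kerSet {M : Type*} [AddCommGroup M] (D : Set M) : Set M :=
  {x | (fun d => x + d) '' D = D}

/-- The dimension of the kernel of a binary code. -/
noncomputable def dimKer {M : Type*} [AddCommGroup M] [Module (ZMod 2) M] (D : Set M) : ℕ :=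
  Module.finrank (ZMod 2) (Submodule.span (ZMod 2) (kerSet D))

/-- The rank of a binary code: the dimension of its linear span. -/
noncomputable def rankOf {M : Type*} [AddCommGroup M] [Module (ZMod 2) M] (D : Set M) : ℕ :=
  Module.finrank (ZMod 2) (Submodule.span (ZMod 2) D)

/-- `Φ(S)` is linear (closed under addition). -/
def grayAddClosed (S : Set (V α β)) : Prop :=
  ∀ x ∈ Phi '' S, ∀ y ∈ Phi '' S, x + y ∈ Phi '' S

/-- `φ(D)` is linear (closed under addition), for a quaternary code. -/
def grayAddClosedQ (D : Set (Fin β → ZMod 4)) : Prop :=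
  ∀ x ∈ phi '' D, ∀ y ∈ phi '' D, x + y ∈ phi '' D

/-- The modulo-2 reduction `ℤ₄ → ℤ₂`. -/
def red2c : ZMod 4 →+* ZMod 2 := ZMod.castHom (show 2 ∣ 4 by norm_num) (ZMod 2)

/-- The modulo-2 reduction of a polynomial over `ℤ₄`. -/
noncomputable def red2 : Polynomial (ZMod 4) →+* Polynomial (ZMod 2) := Polynomial.mapRingHom red2c

/-- Scalar multiplication of `c ∈ ℤ₄` on `ℤ₂^α × ℤ₄^β` (mod-2 reduction on the binary part). -/
def smul4 (c : ZMod 4) (v : V α β) : V α β := (red2c c • v.1, c • v.2)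

/-- The action of a polynomial `p ∈ ℤ₄[x]`: `p ⋆ v = ∑ p_j • π^j(v)`, which is the
module action of `ℤ₄[x]` on `ℤ₂[x]/(x^α-1) × ℤ₄[x]/(x^β-1)` in vector form. -/
noncomputable def polyAct (p : Polynomial (ZMod 4)) (v : V α β) : V α β :=
  ∑ j ∈ Finset.range (p.natDegree + 1), smul4 (p.coeff j) (shift^[j] v)

/-- The vector in `ℤ₂^α` corresponding to `p mod (x^α - 1)`. -/
noncomputable def toVec2 (p : Polynomial (ZMod 2)) : Fin α → ZMod 2 :=
  fun i => ∑ j ∈ Finset.range (p.natDegree + 1), if j % α = (i : ℕ) then p.coeff j else 0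

/-- The vector in `ℤ₄^β` corresponding to `p mod (x^β - 1)`. -/
noncomputable def toVec4 (p : Polynomial (ZMod 4)) : Fin β → ZMod 4 :=
  fun i => ∑ j ∈ Finset.range (p.natDegree + 1), if j % β = (i : ℕ) then p.coeff j else 0

/-- The `ℤ₄[x]`-submodule of `R_{α,β}` generated by `(b | 0)` and `(ℓ | a)`, in vector form. -/
def genCode (α β : ℕ) (b ℓ : Polynomial (ZMod 2)) (a : Polynomial (ZMod 4)) : Set (V α β) :=
  {x : V α β | ∃ p q : Polynomial (ZMod 4),
    x = polyAct p (toVec2 b, 0) + polyAct q (toVec2 ℓ, toVec4 a)}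

/-- The `ℤ₂ℤ₄`-additive cyclic code `⟨(b | 0), (ℓ | fh + 2f)⟩`. -/
def stdCode (α β : ℕ) (b ℓ : Polynomial (ZMod 2)) (f h : Polynomial (ZMod 4)) : Set (V α β) :=
  genCode α β b ℓ (f * h + 2 * f)

end Z2Z4

namespace Z2Z4

section FoldVec

variable {A : Type*} [CommRing A] {n : ℕ}

/-- The coefficient vector of the residue of `p` modulo `x^n - 1`, as an additive map. -/
noncomputable def foldVec (A : Type*) [CommRing A] (n : ℕ) : A[X] →+ (Fin n → A) where
  toFun p := fun i => p.sum fun j c => if j % n = (i : ℕ) then c else 0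
  map_zero' := by ext i; simp
  map_add' p q := by
    ext i
    refine Polynomial.sum_add_index p q _ (fun j => by simp) (fun j c d => ?_)
    split_ifs <;> simp

theorem foldVec_monomial (k : ℕ) (c : A) :
    foldVec A n (monomial k c) = fun i : Fin n => if k % n = (i : ℕ) then c else 0 := by
  ext i
  exact Polynomial.sum_monomial_index (f := fun j c => if j % n = (i : ℕ) then c else 0) c
    (by simp)

theorem foldVec_eq_sum_range (p : A[X]) :
    foldVec A n p = fun i : Fin n =>
      ∑ j ∈ Finset.range (p.natDegree + 1), if j % n = (i : ℕ) then p.coeff j else 0 := by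
  ext i
  exact Polynomial.sum_over_range (f := fun j c => if j % n = (i : ℕ) then c else 0) p
    (fun j => by simp)

theorem foldVec_C_mul (c : A) (p : A[X]) : foldVec A n (C c * p) = c • foldVec A n p := by
  induction p using Polynomial.induction_on' with
  | add p q hp hq => rw [mul_add, map_add, map_add, hp, hq, smul_add]
  | monomial k d =>
    rw [C_mul_monomial, foldVec_monomial, foldVec_monomial]
    ext i
    simp

theorem mod_eq_finRotate_symm_iff (k : ℕ) (i : Fin n) :
    k % n = ((finRotate n).symm i : ℕ) ↔ (k + 1) % n = (i : ℕ) := by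
  obtain ⟨j, rfl⟩ := (finRotate n).surjective i
  rw [Equiv.symm_apply_apply]
  cases n with
  | zero => exact j.elim0
  | succ m =>
    have hj := j.isLt
    have hk := Nat.mod_lt k (Nat.succ_pos m)
    rw [coe_finRotate, ← Nat.mod_add_mod]
    simp only [Fin.ext_iff, Fin.val_last]
    generalize k % (m + 1) = a at hk
    rcases Nat.lt_or_ge a m with ha | ha
    · rw [Nat.mod_eq_of_lt (by omega)]
      split_ifs <;> grind
    · obtain rfl : a = m := by omega
      rw [Nat.mod_self]
      split_ifs <;> grind

theorem foldVec_X_mul (p : A[X]) :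
    foldVec A n (X * p) = fun i => foldVec A n p ((finRotate n).symm i) := by
  induction p using Polynomial.induction_on' with
  | add p q hp hq =>
    rw [mul_add, map_add, map_add, hp, hq]
    rfl
  | monomial k d =>
    rw [X_mul_monomial, foldVec_monomial, foldVec_monomial]
    ext i
    simp only [mod_eq_finRotate_symm_iff]

theorem foldVec_X_pow_sub_one_mul (p : A[X]) : foldVec A n ((X ^ n - 1) * p) = 0 := by
  rw [sub_mul, one_mul, map_sub, sub_eq_zero]
  induction p using Polynomial.induction_on' with
  | add p q hp hq => rw [mul_add, map_add, map_add, hp, hq]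
  | monomial k d =>
    rw [X_pow_mul_monomial, foldVec_monomial, foldVec_monomial]
    simp

theorem foldVec_surjective : Function.Surjective (foldVec A n) := by
  intro v
  refine ⟨∑ i : Fin n, monomial (i : ℕ) (v i), ?_⟩
  rw [map_sum]
  ext i
  simp [foldVec_monomial, Finset.sum_apply, Nat.mod_eq_of_lt, Fin.val_inj]

end FoldVec

theorem toVec2_eq_foldVec (p : (ZMod 2)[X]) : (toVec2 p : Fin α → ZMod 2) = foldVec _ α p :=
  (foldVec_eq_sum_range p).symm

theorem toVec4_eq_foldVec (p : (ZMod 4)[X]) : (toVec4 p : Fin β → ZMod 4) = foldVec _ β p :=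
  (foldVec_eq_sum_range p).symm

/-- The action of constants on `ℤ₂^α × ℤ₄^β` as a ring homomorphism. -/
def smul4Hom (α β : ℕ) : ZMod 4 →+* AddMonoid.End (V α β) where
  toFun c :=
    { toFun := smul4 c
      map_zero' := by simp [smul4]
      map_add' := fun v w => by simp [smul4] }
  map_one' := AddMonoidHom.ext fun v => by
    change smul4 1 v = v
    simp [smul4]
  map_mul' c d := AddMonoidHom.ext fun v => by
    change smul4 (c * d) v = smul4 c (smul4 d v)
    simp [smul4, mul_smul]
  map_zero' := AddMonoidHom.ext fun v => by
    change smul4 0 v = 0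
    simp [smul4]
  map_add' c d := AddMonoidHom.ext fun v => by
    change smul4 (c + d) v = smul4 c v + smul4 d v
    simp [smul4, add_smul]

/-- The double cyclic shift as an additive endomorphism. -/
def shiftHom (α β : ℕ) : AddMonoid.End (V α β) where
  toFun := shift
  map_zero' := rfl
  map_add' _ _ := rfl

/-- The action of `ℤ₄[x]` on `ℤ₂^α × ℤ₄^β` as a ring homomorphism. -/
noncomputable def polyActHom (α β : ℕ) : (ZMod 4)[X] →+* AddMonoid.End (V α β) :=
  Polynomial.eval₂RingHom' (smul4Hom α β) (shiftHom α β) fun _ => by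
    ext v i <;> rfl

theorem polyActHom_apply (p : (ZMod 4)[X]) (v : V α β) : polyActHom α β p v = polyAct p v := by
  change (eval₂ (smul4Hom α β) (shiftHom α β) p) v = _
  rw [eval₂_eq_sum_range]
  have key : ∀ j, (shiftHom α β ^ j : AddMonoid.End (V α β)) v = shift^[j] v := by
    intro j
    rw [AddMonoid.End.coe_pow]
    rfl
  refine (AddMonoidHom.finsetSum_apply _ _ _).trans ?_
  refine Finset.sum_congr rfl fun j _ => ?_
  rw [← key]
  rfl

theorem polyAct_pair (p : (ZMod 4)[X]) (u : (ZMod 2)[X]) (a : (ZMod 4)[X]) :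
    polyAct p (foldVec _ α u, foldVec _ β a) =
      (foldVec _ α (red2 p * u), foldVec _ β (p * a)) := by
  rw [← polyActHom_apply]
  induction p using Polynomial.induction_on with
  | C c =>
    have hc : red2 (C c) = C (red2c c) := by simp [red2]
    rw [hc, foldVec_C_mul, foldVec_C_mul]
    change (eval₂ (smul4Hom α β) (shiftHom α β) (C c)) _ = _
    rw [eval₂_C]
    rfl
  | add p q hp hq =>
    rw [map_add, map_add, add_mul, add_mul, map_add, map_add, ← Prod.mk_add_mk, ← hp, ← hq]
    rfl
  | monomial k c ih =>
    have hX : red2 (X : (ZMod 4)[X]) = X := by simp [red2]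
    have e : C c * X ^ (k + 1) = X * (C c * X ^ k) := by ring
    have hX' : polyActHom α β X = shiftHom α β := eval₂_X _ _
    rw [e, map_mul, map_mul red2, hX, hX', mul_assoc, mul_assoc, foldVec_X_mul, foldVec_X_mul]
    exact congrArg shift ih

theorem red2_surjective : Function.Surjective red2 :=
  Polynomial.map_surjective _ (ZMod.castHom_surjective _)

theorem exists_eq_two_mul_of_red2_eq_zero {p : (ZMod 4)[X]} (hp : red2 p = 0) :
    ∃ k, p = 2 * k := by
  have h : C (2 : ZMod 4) ∣ p := by
    rw [C_dvd_iff_dvd_coeff]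
    intro i
    have hi : red2c (p.coeff i) = 0 := by
      have := congrArg (fun q => q.coeff i) hp
      simpa [red2] using this
    have key : ∀ c : ZMod 4, red2c c = 0 → ∃ d, c = 2 * d := by decide
    exact key _ hi
  exact h

theorem exists_eq_add_two_mul {p q : (ZMod 4)[X]} (hpq : red2 p = red2 q) :
    ∃ k, p = q + 2 * k := by
  obtain ⟨k, hk⟩ := exists_eq_two_mul_of_red2_eq_zero
    (p := p - q) (by rw [map_sub, hpq, sub_self])
  exact ⟨k, by linear_combination hk⟩

theorem four_eq_zero_poly : (4 : (ZMod 4)[X]) = 0 := by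
  have : (C (4 : ZMod 4) : (ZMod 4)[X]) = 0 := by
    rw [show (4 : ZMod 4) = 0 from by decide, C_0]
  exact this

theorem two_mul_eq_of_red2_eq {p q : (ZMod 4)[X]} (hpq : red2 p = red2 q) : 2 * p = 2 * q := by
  obtain ⟨k, hk⟩ := exists_eq_add_two_mul hpq
  linear_combination 2 * hk + k * four_eq_zero_poly

theorem exists_mul_add_mul_eq_one_add {p q : (ZMod 4)[X]} (h : IsCoprime (red2 p) (red2 q)) :
    ∃ s t k, s * p + t * q = 1 + 2 * k := by
  obtain ⟨s, t, hst⟩ := h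
  obtain ⟨s, rfl⟩ := red2_surjective s
  obtain ⟨t, rfl⟩ := red2_surjective t
  obtain ⟨k, hk⟩ := exists_eq_add_two_mul (p := s * p + t * q) (q := 1) (by simpa using hst)
  exact ⟨s, t, k, hk⟩

/-- Hensel lifting of a coprime factorization from `ℤ₂[x]` to `ℤ₄[x]`. -/
theorem exists_lift_factorization {f : (ZMod 4)[X]} {u v : (ZMod 2)[X]}
    (hf : red2 f = u * v) (huv : IsCoprime u v) :
    ∃ p q, f = p * q ∧ red2 p = u ∧ red2 q = v := by
  obtain ⟨p, rfl⟩ := red2_surjective u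
  obtain ⟨q, rfl⟩ := red2_surjective v
  obtain ⟨c, hc⟩ := exists_eq_add_two_mul (p := f) (q := p * q) (by simpa using hf)
  obtain ⟨s, t, k, hk⟩ := exists_mul_add_mul_eq_one_add huv
  have h2 : red2 (2 : (ZMod 4)[X]) = 0 := by
    rw [map_ofNat]
    exact CharTwo.two_eq_zero
  refine ⟨p + 2 * (c * t), q + 2 * (c * s), ?_, by simp [h2], by simp [h2]⟩
  linear_combination hc - 2 * c * hk + (-c * k - c * c * s * t) * four_eq_zero_poly

/-- The modulo-2 residue of the quaternary part, read off from the Gray image. -/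
def grayResidue (α β : ℕ) : B α β →ₗ[ZMod 2] (Fin β → ZMod 2) where
  toFun x := x.2.1 + x.2.2
  map_add' x y := by simp; abel
  map_smul' c x := by simp

/-- The binary image of `2v*w`, as a bilinear function of the Gray images. -/
def grayStar (x y : B α β) : B α β :=
  (0, (grayResidue α β x * grayResidue α β y, grayResidue α β x * grayResidue α β y))

theorem Phi_add (v w : V α β) : Phi (v + w) = Phi v + Phi w + grayStar (Phi v) (Phi w) := by
  have h1 : ∀ a b : ZMod 4, grayHat (a + b) = grayHat a + grayHat b +
      (grayHat a + (grayTilde a + grayHat a)) * (grayHat b + (grayTilde b + grayHat b)) := by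
    decide
  have h2 : ∀ a b : ZMod 4, grayTilde (a + b) + grayHat (a + b) =
      (grayTilde a + grayHat a) + (grayTilde b + grayHat b) +
      (grayHat a + (grayTilde a + grayHat a)) * (grayHat b + (grayTilde b + grayHat b)) := by
    decide
  refine Prod.ext ?_ (Prod.ext ?_ ?_)
  · exact (add_zero _).symm
  · funext i
    exact h1 _ _
  · funext i
    exact h2 _ _

theorem grayResidue_Phi (v : V α β) : grayResidue α β (Phi v) = fun i => red2c (v.2 i) := by
  have h : ∀ a : ZMod 4, grayHat a + (grayTilde a + grayHat a) = red2c a := by decide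
  funext i
  exact h _

section Span

variable {S : Set (V α β)}

theorem subset_R : S ⊆ R S := fun _ hv => Submodule.subset_span ⟨_, hv, rfl⟩

theorem grayStar_mem_span (hS : ∀ v ∈ S, ∀ w ∈ S, v + w ∈ S) {x y : B α β}
    (hx : x ∈ Submodule.span (ZMod 2) (Phi '' S)) (hy : y ∈ Submodule.span (ZMod 2) (Phi '' S)) :
    grayStar x y ∈ Submodule.span (ZMod 2) (Phi '' S) := by
  induction hx, hy using Submodule.span_induction₂ with
  | mem_mem x y hx hy =>
    obtain ⟨v, hv, rfl⟩ := hx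
    obtain ⟨w, hw, rfl⟩ := hy
    have e : grayStar (Phi v) (Phi w) = Phi (v + w) - (Phi v + Phi w) := by
      rw [Phi_add]; abel
    rw [e]
    exact sub_mem (subset_R (hS v hv w hw)) (add_mem (subset_R hv) (subset_R hw))
  | zero_left y hy =>
    convert Submodule.zero_mem _
    simp [grayStar]
  | zero_right x hx =>
    convert Submodule.zero_mem _
    simp [grayStar]
  | add_left x y z _ _ _ h1 h2 =>
    convert add_mem h1 h2
    simp [grayStar, add_mul]
  | add_right x y z _ _ _ h1 h2 =>
    convert add_mem h1 h2
    simp [grayStar, mul_add]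
  | smul_left r x y _ _ h1 =>
    convert Submodule.smul_mem _ r h1
    simp [grayStar]
  | smul_right r x y _ _ h1 =>
    convert Submodule.smul_mem _ r h1
    simp [grayStar]

theorem R_add_mem (hS : ∀ v ∈ S, ∀ w ∈ S, v + w ∈ S) {v w : V α β}
    (hv : v ∈ R S) (hw : w ∈ R S) : v + w ∈ R S := by
  change Phi (v + w) ∈ Submodule.span (ZMod 2) (Phi '' S)
  rw [Phi_add]
  exact add_mem (add_mem hv hw) (grayStar_mem_span hS hv hw)

theorem R_zero_mem : (0 : V α β) ∈ R S := by
  have h : Phi (0 : V α β) = 0 := by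
    have h1 : grayHat 0 = 0 := by decide
    have h2 : grayTilde 0 + grayHat 0 = 0 := by decide
    exact Prod.ext rfl (Prod.ext (funext fun _ => h1) (funext fun _ => h2))
  change Phi 0 ∈ Submodule.span (ZMod 2) (Phi '' S)
  rw [h]
  exact zero_mem _

/-- The shift induced on Gray images. -/
def grayShift (α β : ℕ) : B α β →ₗ[ZMod 2] B α β where
  toFun x := (fun i => x.1 ((finRotate α).symm i),
    (fun i => x.2.1 ((finRotate β).symm i), fun i => x.2.2 ((finRotate β).symm i)))
  map_add' _ _ := rfl
  map_smul' _ _ := rfl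

theorem R_shift_mem (hS : ∀ v ∈ S, shift v ∈ S) {v : V α β} (hv : v ∈ R S) :
    shift v ∈ R S := by
  have h : Submodule.span (ZMod 2) (Phi '' S) ≤
      (Submodule.span (ZMod 2) (Phi '' S)).comap (grayShift α β) := by
    rw [Submodule.span_le]
    rintro _ ⟨w, hw, rfl⟩
    exact subset_R (hS w hw)
  exact h hv

theorem R_polyAct_mem (hadd : ∀ v ∈ S, ∀ w ∈ S, v + w ∈ S) (hshift : ∀ v ∈ S, shift v ∈ S)
    (p : (ZMod 4)[X]) {v : V α β} (hv : v ∈ R S) : polyAct p v ∈ R S := by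
  have hnsmul : ∀ (n : ℕ) {w : V α β}, w ∈ R S → n • w ∈ R S := by
    intro n w hw
    induction n with
    | zero => rw [zero_smul]; exact R_zero_mem
    | succ n ih => rw [succ_nsmul]; exact R_add_mem hadd ih hw
  have hsmul : ∀ (c : ZMod 4) {w : V α β}, w ∈ R S → smul4 c w ∈ R S := by
    intro c w hw
    have e : smul4 c w = c.val • w := by
      change smul4Hom α β c w = _
      conv_lhs => rw [← ZMod.natCast_zmod_val c]
      rw [map_natCast, AddMonoid.End.natCast_apply]
    rw [e]
    exact hnsmul _ hw
  have hiter : ∀ j, shift^[j] v ∈ R S := by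
    intro j
    induction j with
    | zero => exact hv
    | succ j ih => rw [Function.iterate_succ_apply']; exact R_shift_mem hshift ih
  exact Finset.sum_induction _ (· ∈ R S) (fun _ _ => R_add_mem hadd) R_zero_mem
    fun j _ => hsmul _ (hiter j)

theorem exists_eq_add_two_mul_of_mem_R (hne : S.Nonempty)
    (hsub : ∀ v ∈ S, ∀ w ∈ S, v - w ∈ S) {x : V α β} (hx : x ∈ R S) :
    ∃ c ∈ S, ∃ w : Fin β → ZMod 4, x.2 = c.2 + 2 * w := by
  have hzero : (0 : V α β) ∈ S := by
    obtain ⟨v, hv⟩ := hne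
    simpa using hsub v hv v hv
  have hadd : ∀ v ∈ S, ∀ w ∈ S, v + w ∈ S := fun v hv w hw => by
    simpa using hsub v hv _ (hsub 0 hzero w hw)
  have key : ∀ y ∈ Submodule.span (ZMod 2) (Phi '' S),
      ∃ c ∈ S, grayResidue α β y = fun i => red2c (c.2 i) := by
    intro y hy
    induction hy using Submodule.span_induction with
    | mem y hy =>
      obtain ⟨v, hv, rfl⟩ := hy
      exact ⟨v, hv, grayResidue_Phi v⟩
    | zero => exact ⟨0, hzero, by funext i; simp⟩
    | add y z _ _ h1 h2 =>
      obtain ⟨c, hc, e1⟩ := h1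
      obtain ⟨d, hd, e2⟩ := h2
      exact ⟨c + d, hadd c hc d hd, by rw [map_add, e1, e2]; funext i; simp⟩
    | smul a y _ h1 =>
      obtain ⟨c, hc, e1⟩ := h1
      obtain rfl | rfl : a = 0 ∨ a = 1 := by revert a; decide
      · exact ⟨0, hzero, by funext i; simp⟩
      · exact ⟨c, hc, by rw [one_smul, e1]⟩
  obtain ⟨c, hc, e⟩ := key _ hx
  rw [grayResidue_Phi] at e
  have h4 : ∀ a b : ZMod 4, red2c a = red2c b → ∃ w, a = b + 2 * w := by decide
  choose w hw using fun i => h4 _ _ (congrFun e i)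
  exact ⟨c, hc, w, funext hw⟩

end Span

section GenCode

variable {b ℓ : (ZMod 2)[X]} {a : (ZMod 4)[X]}

theorem mem_genCode_iff {x : V α β} : x ∈ genCode α β b ℓ a ↔ ∃ p q : (ZMod 4)[X],
    x = (foldVec _ α (red2 p * b + red2 q * ℓ), foldVec _ β (q * a)) := by
  have h : ∀ p q : (ZMod 4)[X],
      polyAct p ((toVec2 b, 0) : V α β) + polyAct q (toVec2 ℓ, toVec4 a) =
      (foldVec _ α (red2 p * b + red2 q * ℓ), foldVec _ β (q * a)) := by
    intro p q
    rw [toVec2_eq_foldVec, toVec2_eq_foldVec, toVec4_eq_foldVec,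
      ← map_zero (foldVec (ZMod 4) β), polyAct_pair, polyAct_pair]
    simp
  simp only [genCode, Set.mem_ofPred_eq, h]

theorem genCode_sub_mem {v w : V α β} (hv : v ∈ genCode α β b ℓ a)
    (hw : w ∈ genCode α β b ℓ a) : v - w ∈ genCode α β b ℓ a := by
  rw [mem_genCode_iff] at *
  obtain ⟨p, q, rfl⟩ := hv
  obtain ⟨p', q', rfl⟩ := hw
  refine ⟨p - p', q - q', ?_⟩
  rw [Prod.mk_sub_mk, ← map_sub, ← map_sub]
  congr 2
  · simp only [map_sub]; ring
  · ring

theorem genCode_add_mem {v w : V α β} (hv : v ∈ genCode α β b ℓ a)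
    (hw : w ∈ genCode α β b ℓ a) : v + w ∈ genCode α β b ℓ a := by
  have h := genCode_sub_mem hv (genCode_sub_mem (genCode_sub_mem hw hw) hw)
  simpa using h

theorem genCode_zero_mem : (0 : V α β) ∈ genCode α β b ℓ a :=
  mem_genCode_iff.2 ⟨0, 0, by simp [Prod.mk_zero_zero]⟩

theorem genCode_shift_mem {v : V α β} (hv : v ∈ genCode α β b ℓ a) :
    shift v ∈ genCode α β b ℓ a := by
  rw [mem_genCode_iff] at *
  obtain ⟨p, q, rfl⟩ := hv
  have hX : red2 (X : (ZMod 4)[X]) = X := by simp [red2]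
  refine ⟨X * p, X * q, ?_⟩
  rw [mul_assoc, foldVec_X_mul, map_mul red2, map_mul red2, hX, mul_assoc, mul_assoc, ← mul_add,
    foldVec_X_mul]
  rfl

end GenCode

/-- For a `ℤ₂ℤ₄`-additive cyclic code `C = ⟨(b | 0), (ℓ | fh + 2f)⟩` in
standard form, there are a divisor `r` of `f` (with `f = r * fr`), a divisor `b_r` of
`b`, and `ℓ_r`, such that `R(C) = ⟨(b_r | 0), (ℓ_r | fh + 2(f/r))⟩`. -/
theorem rank_code_generators_exist (α β : ℕ) (hβ : Odd β) (b ℓ : Polynomial (ZMod 2))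
    (f h g : Polynomial (ZMod 4))
    (hfhg : f * h * g = X ^ β - 1) (hb : b ∣ X ^ α - 1) (hℓ : ℓ.degree < b.degree) :
    ∃ (r fr : Polynomial (ZMod 4)) (br ℓr : Polynomial (ZMod 2)),
      f = r * fr ∧ br ∣ b ∧
      R (stdCode α β b ℓ f h) = genCode α β br ℓr (f * h + 2 * fr) := by
  set S := stdCode α β b ℓ f h
  have hadd : ∀ v ∈ S, ∀ w ∈ S, v + w ∈ S := fun v hv w hw => genCode_add_mem hv hw
  have hshift : ∀ v ∈ S, shift v ∈ S := fun v hv => genCode_shift_mem hv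
  have hsub : ∀ v ∈ S, ∀ w ∈ S, v - w ∈ S := fun v hv w hw => genCode_sub_mem hv hw
  have hRadd : ∀ {u v : (ZMod 2)[X]} {p q : (ZMod 4)[X]},
      ((foldVec _ α u, foldVec _ β p) : V α β) ∈ R S →
      ((foldVec _ α v, foldVec _ β q) : V α β) ∈ R S →
      ((foldVec _ α (u + v), foldVec _ β (p + q)) : V α β) ∈ R S := by
    intro u v p q h1 h2
    rw [map_add, map_add]
    exact R_add_mem hadd h1 h2
  have hRmul : ∀ (s : (ZMod 4)[X]) {u : (ZMod 2)[X]} {p : (ZMod 4)[X]},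
      ((foldVec _ α u, foldVec _ β p) : V α β) ∈ R S →
      ((foldVec _ α (red2 s * u), foldVec _ β (s * p)) : V α β) ∈ R S := by
    intro s u p h1
    rw [← polyAct_pair]
    exact R_polyAct_mem hadd hshift s h1
  have hbmem : ((foldVec _ α b, foldVec _ β 0) : V α β) ∈ R S :=
    subset_R (mem_genCode_iff.2 ⟨1, 0, by simp⟩)
  have hℓmem : ((foldVec _ α ℓ, foldVec _ β (f * h + 2 * f)) : V α β) ∈ R S :=
    subset_R (mem_genCode_iff.2 ⟨0, 1, by simp⟩)
  let J : Ideal (ZMod 4)[X] :=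
    { carrier := {p | ∃ u, ((foldVec _ α u, foldVec _ β p) : V α β) ∈ R S}
      zero_mem' := ⟨0, by rw [map_zero, map_zero]; exact R_zero_mem⟩
      add_mem' := fun ⟨u, hu⟩ ⟨v, hv⟩ => ⟨_, hRadd hu hv⟩
      smul_mem' := fun s _ ⟨u, hu⟩ => ⟨_, hRmul s hu⟩ }
  have hJX : X ^ β - 1 ∈ J := by
    refine ⟨0, ?_⟩
    rw [map_zero, ← mul_one (X ^ β - 1), foldVec_X_pow_sub_one_mul]
    exact R_zero_mem
  have hJgen : f * h + 2 * f ∈ J := ⟨_, hℓmem⟩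
  have hsep : (red2 f * red2 h * red2 g).Separable := by
    have e : red2 f * red2 h * red2 g = X ^ β - 1 := by
      rw [← map_mul, ← map_mul, hfhg]; simp [red2]
    rw [e, X_pow_sub_one_separable_iff, Ne, ZMod.natCast_eq_zero_iff_even, Nat.not_even_iff_odd]
    exact hβ
  have h4 := four_eq_zero_poly
  have hJf : 2 * f ∈ J := by
    have hcop : IsCoprime (red2 h) (red2 g) :=
      hsep.isCoprime.of_mul_left_right
    obtain ⟨s, t, k, hk⟩ := exists_mul_add_mul_eq_one_add hcop
    have e : 2 * f = (2 * s + t * g) * (f * h + 2 * f) + (-t) * (X ^ β - 1) := by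
      linear_combination (-2 * f) * hk - t * hfhg + (-s * f - k * f) * h4
    rw [e]
    exact J.add_mem (J.mul_mem_left _ hJgen) (J.mul_mem_left _ hJX)
  let J₂ : Ideal (ZMod 2)[X] :=
    Ideal.map red2 (Submodule.comap (LinearMap.lsmul (ZMod 4)[X] (ZMod 4)[X] 2) J)
  have hJ₂ : ∀ p : (ZMod 4)[X], red2 p ∈ J₂ ↔ 2 * p ∈ J := by
    intro p
    rw [Ideal.mem_map_iff_of_surjective red2 red2_surjective]
    refine ⟨?_, fun hp => ⟨p, hp, rfl⟩⟩
    rintro ⟨q, hq, hqp⟩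
    rw [← two_mul_eq_of_red2_eq hqp]
    exact hq
  obtain ⟨e, he⟩ := (IsPrincipalIdealRing.principal J₂).principal
  obtain ⟨w, hw⟩ : e ∣ red2 f := by
    rw [← Ideal.mem_span_singleton, ← Ideal.submodule_span_eq, ← he, hJ₂]
    exact hJf
  have hew : IsCoprime e w := by
    have := hsep.of_mul_left.of_mul_left
    rw [hw] at this
    exact this.isCoprime
  obtain ⟨fr, r, hfr, hfre, hrw⟩ := exists_lift_factorization hw hew
  have hJfr : 2 * fr ∈ J := by
    rw [← hJ₂, hfre, he]
    exact Submodule.mem_span_singleton_self e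
  have hJgen' : f * h + 2 * fr ∈ J := by
    have e1 : f * h + 2 * fr = (f * h + 2 * f) - 2 * f + 2 * fr := by ring
    rw [e1]
    exact J.add_mem (J.sub_mem hJgen hJf) hJfr
  obtain ⟨A, D, hAD⟩ : ∃ A D, 2 * fr = A * (f * h + 2 * fr) + (X ^ β - 1) * D := by
    have hcop : IsCoprime (red2 (r * h)) (red2 g) := by
      have := hsep
      rw [hw, ← hrw, mul_assoc e, ← map_mul] at this
      exact this.isCoprime.of_mul_left_right
    obtain ⟨s, t, k, hk⟩ := exists_mul_add_mul_eq_one_add hcop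
    refine ⟨2 * s + t * g, -t, ?_⟩
    linear_combination (-2 * fr) * hk - t * hfhg + (-s * fr - k * fr) * h4 - 2 * s * h * hfr
  have hsnd : ∀ x ∈ R S, ∃ q, x.2 = foldVec _ β (q * (f * h + 2 * fr)) := by
    intro x hx
    obtain ⟨c, hc, v, hv⟩ := exists_eq_add_two_mul_of_mem_R ⟨_, genCode_zero_mem⟩ hsub hx
    obtain ⟨p, q, rfl⟩ := mem_genCode_iff.1 hc
    obtain ⟨P, rfl⟩ := foldVec_surjective v
    obtain ⟨u, hu⟩ := foldVec_surjective x.1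
    have hx2 : x.2 = foldVec _ β (q * (f * h + 2 * f) + 2 * P) := by
      have h2 : foldVec _ β (2 * P) = (2 : ZMod 4) • foldVec _ β P := foldVec_C_mul 2 P
      rw [hv, map_add (foldVec _ β), h2]
      rfl
    have hP : 2 * P ∈ J := by
      have hmem : q * (f * h + 2 * f) + 2 * P ∈ J := by
        refine ⟨u, ?_⟩
        rw [hu, ← hx2]
        exact hx
      exact (J.add_mem_iff_right (J.mul_mem_left q hJgen)).1 hmem
    rw [← hJ₂, he, Ideal.submodule_span_eq, Ideal.mem_span_singleton] at hP
    obtain ⟨m, hm⟩ := hP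
    obtain ⟨M, rfl⟩ := red2_surjective m
    have hPM : 2 * P = 2 * (fr * M) :=
      two_mul_eq_of_red2_eq (by rw [hm, map_mul, hfre])
    refine ⟨q + (q * r + M - q) * A, ?_⟩
    have e1 : q * (f * h + 2 * f) + 2 * P = (q + (q * r + M - q) * A) * (f * h + 2 * fr) +
        (X ^ β - 1) * ((q * r + M - q) * D) := by
      linear_combination hPM + 2 * q * hfr + (q * r + M - q) * hAD
    rw [hx2, e1, map_add, foldVec_X_pow_sub_one_mul, add_zero]
  obtain ⟨ℓr, hℓr⟩ := hJgen'
  let I : Ideal (ZMod 2)[X] :=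
    { carrier := {u | ((foldVec _ α u, foldVec _ β 0) : V α β) ∈ R S}
      zero_mem' := by
        change ((foldVec _ α 0, foldVec _ β 0) : V α β) ∈ R S
        rw [map_zero, map_zero]
        exact R_zero_mem
      add_mem' := fun hu hv => by
        have := hRadd hu hv
        rwa [add_zero] at this
      smul_mem' := fun s u hu => by
        obtain ⟨s, rfl⟩ := red2_surjective s
        have := hRmul s hu
        rwa [mul_zero] at this }
  obtain ⟨br, hbr⟩ := (IsPrincipalIdealRing.principal I).principal
  have hI : ∀ u, u ∈ I ↔ br ∣ u := by
    intro u
    rw [hbr, Ideal.submodule_span_eq, Ideal.mem_span_singleton]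
  refine ⟨r, fr, br, ℓr, by rw [hfr, mul_comm], (hI b).1 hbmem, Set.ext fun x => ?_⟩
  rw [mem_genCode_iff]
  constructor
  · intro hx
    obtain ⟨q, hq⟩ := hsnd x hx
    obtain ⟨u, hu⟩ := foldVec_surjective x.1
    obtain rfl : x = (foldVec _ α u, foldVec _ β (q * (f * h + 2 * fr))) :=
      Prod.ext hu.symm hq
    have hmem : u + red2 (-q) * ℓr ∈ I := by
      have := hRadd hx (hRmul (-q) hℓr)
      rwa [neg_mul, add_neg_cancel] at this
    obtain ⟨k, hk⟩ := (hI _).1 hmem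
    obtain ⟨K, rfl⟩ := red2_surjective k
    refine ⟨K, q, ?_⟩
    have e1 : u = red2 K * br + red2 q * ℓr := by
      rw [map_neg] at hk
      linear_combination hk
    rw [← e1]
  · rintro ⟨p, q, rfl⟩
    have := hRadd (hRmul p ((hI br).2 dvd_rfl)) (hRmul q hℓr)
    rwa [mul_zero, zero_add] at this

end Z2Z4
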